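/- arXiv:math/0305393 — 2 statements merged into one kernel-verified Lean document; each statement's English description precedes it below -/
import Mathlib

section
/- For all positive integers q, n and every integer k ≥ 1, #{σ ∈ S_{n+q−1} : Del_q(σ) − 1 = Des_q(σ) and #Del_q(σ) = k−1} = (q−1)! · q^k · S(n,k). -/
open Finset

/-- The Coxeter generator `s_j = (j, j+1)` of the symmetric group on `{1,…,m}`,
viewed as a permutation of `ℕ` (with 1-based positions). -/
def sgen (j : ℕ) : Equiv.Perm ℕ := Equiv.swap j (j + 1)

/-- The permutation determined by a word in the Coxeter generators,
letters read from left to right and composed as functions. -/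
def wordPerm (L : List ℕ) : Equiv.Perm ℕ := (L.map sgen).prod

/-- The canonical presentation of a permutation of `{1,…,m}` (given as a permutation of `ℕ`
supported on `{1,…,m}`): the unique factorization `w = w₁ w₂ ⋯ w_{m-1}` with
`w_j ∈ R_j = {1, s_j, s_j s_{j-1}, …, s_j ⋯ s_1}`, recorded as the list of indices of the
Coxeter generators appearing, read from left to right. -/
def canonWord : ℕ → Equiv.Perm ℕ → List ℕ
  | 0, _ => []
  | m + 1, π =>
      canonWord m
          (π * (wordPerm ((List.range' (π⁻¹ (m + 1)) (m + 1 - π⁻¹ (m + 1))).reverse))⁻¹)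
        ++ (List.range' (π⁻¹ (m + 1)) (m + 1 - π⁻¹ (m + 1))).reverse

def finIccEquiv (m : ℕ) : Fin m ≃ {i : ℕ // i ∈ Finset.Icc 1 m} where
  toFun a := ⟨a.1 + 1, by have := a.isLt; simp only [Finset.mem_Icc]; omega⟩
  invFun b := ⟨b.1 - 1, by have := b.2; simp only [Finset.mem_Icc] at this; omega⟩
  left_inv a := by ext; simp
  right_inv b := by
    have := b.2
    simp only [Finset.mem_Icc] at this
    ext
    simp only []
    omega

/-- A permutation of `{1,…,m}`, i.e. of `Fin m`, viewed as a permutation of `ℕ`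
(moving only the points `1,…,m`, with `i ∈ Fin m` corresponding to the point `i+1`). -/
def natPerm {m : ℕ} (π : Equiv.Perm (Fin m)) : Equiv.Perm ℕ :=
  π.extendDomain (finIccEquiv m)

/-- `Del_q` of a permutation of `{1,…,m}`: the set of positions `q+1 ≤ i ≤ m` that are
`(q-1)`-st almost left-to-right minima, i.e. `#{j < i : π(j) < π(i)} ≤ q - 1`. -/
def DelQ (q m : ℕ) (π : Equiv.Perm ℕ) : Finset ℕ :=
  (Finset.Icc (q + 1) m).filter fun i =>
    ((Finset.Ico 1 i).filter fun j => π j < π i).card ≤ q - 1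

/-- The descent set of a permutation of `{1,…,m}`: positions `1 ≤ i ≤ m-1` with `π(i) > π(i+1)`. -/
def DesSet (m : ℕ) (π : Equiv.Perm ℕ) : Finset ℕ :=
  (Finset.Icc 1 (m - 1)).filter fun i => π (i + 1) < π i

/-- `Des_q(π) = (Des(π) ∩ {q,…,m-1}) ∪ (Del_q(π) - 1)`. -/
def DesQ (q m : ℕ) (π : Equiv.Perm ℕ) : Finset ℕ :=
  DesSet m π ∩ Finset.Icc q (m - 1) ∪ (DelQ q m π).image (fun i => i - 1)

/-- The `q`-inversion number of a permutation of `{1,…,m}`: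
`inv_q(π) = Σ_{i=q+1}^m min(i-q, #{j < i : π(j) > π(i)})`. -/
def invQ (q m : ℕ) (π : Equiv.Perm ℕ) : ℕ :=
  ∑ i ∈ Finset.Icc (q + 1) m,
    min (i - q) ((Finset.Ico 1 i).filter fun j => π i < π j).card

/-- The `q`-reverse major index `rmaj_{q,m}(π) = Σ_{i ∈ Des_q(π)} (m - i)`. -/
def rmajQ (q m : ℕ) (π : Equiv.Perm ℕ) : ℕ :=
  ∑ i ∈ DesQ q m π, (m - i)

/-- The `q`-length of a permutation of `{1,…,m}`: the number of letters in the canonical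
presentation, where the generators `s_1, …, s_{q-1}` are not counted. -/
def ellQ (q m : ℕ) (π : Equiv.Perm ℕ) : ℕ :=
  ((canonWord m π).filter fun j => q ≤ j).length

/-- `del_q` of a permutation of `{1,…,m}`: the number of occurrences of the generator `s_q`
in the canonical presentation. -/
def delq (q m : ℕ) (π : Equiv.Perm ℕ) : ℕ := (canonWord m π).count q

/-- The covering map `f_q : S_m → S_{m-q+1}`, defined on the canonical presentation by
`s_j ↦ 1` if `j ≤ q-1` and `s_j ↦ s_{j-q+1}` if `j ≥ q`. -/
def fq (q m : ℕ) (π : Equiv.Perm ℕ) : Equiv.Perm ℕ :=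
  wordPerm (((canonWord m π).filter fun j => q ≤ j).map fun j => j - q + 1)

/-- A permutation of `{1,…,m}` avoids the pattern set `Pat(q)` iff there is no sequence
`1 ≤ i₁ < i₂ < ⋯ < i_{q+1} < m` with `π(i_{q+1}) > π(i_{q+1}+1)` and
`π(i_j) < π(i_{q+1}+1)` for all `1 ≤ j ≤ q`. -/
def AvoidsPat (q m : ℕ) (π : Equiv.Perm ℕ) : Prop :=
  ¬ ∃ f : Fin (q + 1) → ℕ, StrictMono f ∧ 1 ≤ f 0 ∧ f (Fin.last q) < m ∧
      π (f (Fin.last q) + 1) < π (f (Fin.last q)) ∧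
      ∀ a : Fin (q + 1), a ≠ Fin.last q → π (f a) < π (f (Fin.last q) + 1)

/-- The Stirling number of the second kind `S(n,k)`: the number of partitions of
`{1,…,n}` into `k` nonempty blocks. -/
noncomputable def stirling2 (n k : ℕ) : ℕ :=
  Nat.card {P : Finpartition (Finset.univ : Finset (Fin n)) // P.parts.card = k}

/-- The `q`-Bell number `b_q(n) = Σ_k q^k S(n,k)`. -/
noncomputable def qBell (q n : ℕ) : ℕ := ∑ k ∈ Finset.range (n + 1), q ^ k * stirling2 n k

/-- `h_q(m)`: the number of permutations of `{1,…,m}` avoiding all patterns in `Pat(q)`. -/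
noncomputable def hq (q m : ℕ) : ℕ :=
  Nat.card {π : Equiv.Perm (Fin m) // AvoidsPat q m (natPerm π)}

/-- The number of cycles (including fixed points) of a permutation of `{1,…,n}`. -/
def cycleCount {n : ℕ} (σ : Equiv.Perm (Fin n)) : ℕ :=
  σ.cycleType.card + (n - σ.support.card)

/-- The signless Stirling number of the first kind `c(n,k)`: the number of permutations
of `{1,…,n}` with exactly `k` cycles. -/
noncomputable def stirling1 (n k : ℕ) : ℕ :=
  Nat.card {σ : Equiv.Perm (Fin n) // cycleCount σ = k}

namespace Equiv.Perm

variable {m : ℕ}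

/-- The permutation of `Fin (m + 1)` obtained from `σ` by inserting the largest value
at position `p`. -/
def insertLast (p : Fin (m + 1)) (σ : Perm (Fin m)) : Perm (Fin (m + 1)) :=
  (finSuccEquiv' p).trans ((Equiv.optionCongr σ).trans (finSuccEquiv' (Fin.last m)).symm)

@[simp] theorem insertLast_self (p : Fin (m + 1)) (σ : Perm (Fin m)) :
    insertLast p σ p = Fin.last m := by
  simp [insertLast]

@[simp] theorem insertLast_succAbove (p : Fin (m + 1)) (σ : Perm (Fin m)) (i : Fin m) :
    insertLast p σ (p.succAbove i) = (σ i).castSucc := by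
  simp [insertLast]

theorem insertLast_bijective :
    Function.Bijective fun x : Perm (Fin m) × Fin (m + 1) => insertLast x.2 x.1 := by
  rw [Fintype.bijective_iff_injective_and_card]
  constructor
  · rintro ⟨σ, p⟩ ⟨τ, r⟩ h
    simp only at h
    have hpr : p = r := by
      apply (insertLast p σ).injective
      rw [insertLast_self, h, insertLast_self]
    subst hpr
    have hστ : σ = τ := by
      ext1 i
      have := congrArg (fun f => f (p.succAbove i)) h
      simpa using this
    rw [hστ]
  · simp [Fintype.card_perm, Nat.factorial_succ, mul_comm]

/-- The number of positions before `i` carrying a smaller value. -/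
def numSmallerBefore (σ : Perm (Fin m)) (i : Fin m) : ℕ := #{j | j < i ∧ σ j < σ i}

theorem numSmallerBefore_le (σ : Perm (Fin m)) (i : Fin m) : σ.numSmallerBefore i ≤ i := by
  rw [← Fin.card_Iio i]
  exact Finset.card_le_card fun j hj => by simp_all

theorem numSmallerBefore_insertLast_self (p : Fin (m + 1)) (σ : Perm (Fin m)) :
    (insertLast p σ).numSmallerBefore p = p := by
  rw [← Fin.card_Iio p, numSmallerBefore]
  congr 1
  ext j
  simp only [Finset.mem_filter, Finset.mem_univ, true_and, Finset.mem_Iio, and_iff_left_iff_imp]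
  intro hj
  rw [insertLast_self, Fin.lt_last_iff_ne_last]
  intro h
  rw [← insertLast_self p σ] at h
  exact hj.ne ((insertLast p σ).injective h)

theorem numSmallerBefore_insertLast_succAbove (p : Fin (m + 1)) (σ : Perm (Fin m)) (i : Fin m) :
    (insertLast p σ).numSmallerBefore (p.succAbove i) = σ.numSmallerBefore i := by
  have hl : ¬ Fin.last m < (σ i).castSucc := (Fin.le_last _).not_gt
  simp only [numSmallerBefore, Finset.card_filter, Fin.sum_univ_succAbove _ p, insertLast_self,
    insertLast_succAbove, hl, and_false, if_false, zero_add, Fin.succAbove_lt_succAbove_iff,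
    Fin.castSucc_lt_castSucc_iff]

/-- The (zero-based) positions at least `q` that are almost left-to-right minima. -/
def almostMinima (q : ℕ) (σ : Perm (Fin m)) : Finset (Fin m) :=
  {i | q ≤ i.val ∧ σ.numSmallerBefore i < q}

/-- Every descent with bottom at a position at least `q` ends in an almost left-to-right
minimum. -/
def DescentsAreMinima (q : ℕ) (σ : Perm (Fin m)) : Prop :=
  ∀ i j : Fin m, i.val + 1 = j.val → q ≤ j.val → σ j < σ i → σ.numSmallerBefore j < q

theorem _root_.Fin.val_succAbove_eq_ite (p : Fin (m + 1)) (i : Fin m) :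
    (p.succAbove i).val = if i.val < p.val then i.val else i.val + 1 := by
  simp only [Fin.succAbove, Fin.lt_def, Fin.val_castSucc]
  split_ifs <;> simp

theorem card_almostMinima_insertLast (q : ℕ) (p : Fin (m + 1)) (σ : Perm (Fin m))
    (hq : 0 < q) (hqm : q ≤ m) :
    #(almostMinima q (insertLast p σ)) = #(almostMinima q σ) + if p.val < q then 1 else 0 := by
  simp only [almostMinima, Finset.card_filter, Fin.sum_univ_succAbove _ p,
    numSmallerBefore_insertLast_self, numSmallerBefore_insertLast_succAbove]
  rw [if_neg (by omega), zero_add]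
  have key : ∀ i : Fin m, (if q ≤ (p.succAbove i).val ∧ σ.numSmallerBefore i < q then 1 else 0) =
      (if q ≤ i.val ∧ σ.numSmallerBefore i < q then 1 else 0) +
        if i = ⟨q - 1, by omega⟩ then (if p.val < q then 1 else 0) else 0 := by
    intro i
    have h := σ.numSmallerBefore_le i
    simp only [Fin.val_succAbove_eq_ite, Fin.ext_iff]
    split_ifs <;> omega
  rw [Finset.sum_congr rfl fun i _ => key i, Finset.sum_add_distrib]
  simp

theorem descentsAreMinima_insertLast_iff (q : ℕ) (p : Fin (m + 1)) (σ : Perm (Fin m)) :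
    DescentsAreMinima q (insertLast p σ) ↔ DescentsAreMinima q σ ∧
      ∀ i : Fin m, i.val = p.val → q ≤ i.val → i ∈ almostMinima q σ := by
  constructor
  · intro h
    have hp : ∀ i : Fin m, i.val = p.val → q ≤ i.val → σ.numSmallerBefore i < q := by
      intro i hi hqi
      have hs := Fin.val_succAbove_eq_ite p i
      rw [if_neg (by omega)] at hs
      have := h p (p.succAbove i) (by omega) (by omega)
        (by simp)
      rwa [numSmallerBefore_insertLast_succAbove] at this
    refine ⟨fun i j hij hqj hd => ?_, fun i hi hqi => by
      simpa [almostMinima, hqi] using hp i hi hqi⟩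
    by_cases hjp : j.val = p.val
    · exact hp j hjp hqj
    · have hi := Fin.val_succAbove_eq_ite p i
      have hj := Fin.val_succAbove_eq_ite p j
      have := h (p.succAbove i) (p.succAbove j) (by split_ifs at hi hj <;> omega)
        (by split_ifs at hj <;> omega) (by simpa using hd)
      rwa [numSmallerBefore_insertLast_succAbove] at this
  · rintro ⟨h, hp⟩ i j hij hqj hd
    have hle : ∀ k : Fin m, ¬ q ≤ k.val → σ.numSmallerBefore k < q := fun k hk => by
      have := σ.numSmallerBefore_le k
      omega
    rcases Fin.eq_self_or_eq_succAbove p j with rfl | ⟨j, rfl⟩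
    · rw [insertLast_self] at hd
      exact absurd hd (Fin.le_last _).not_gt
    rw [numSmallerBefore_insertLast_succAbove]
    by_cases hqj' : q ≤ j.val
    · have hj := Fin.val_succAbove_eq_ite p j
      rcases Fin.eq_self_or_eq_succAbove p i with rfl | ⟨i, rfl⟩
      · have := hp j (by split_ifs at hj <;> omega) hqj'
        simp only [almostMinima, Finset.mem_filter] at this
        exact this.2.2
      · have hi := Fin.val_succAbove_eq_ite p i
        exact h i j (by split_ifs at hi hj <;> omega) hqj' (by simpa using hd)
    · exact hle j hqj'

/-- The number of permutations of `Fin m` with `d` almost left-to-right minima whose late descents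
all end in almost left-to-right minima. -/
noncomputable def countMinimaDescents (q m d : ℕ) : ℕ := by
  classical exact #{σ : Perm (Fin m) | DescentsAreMinima q σ ∧ #(almostMinima q σ) = d}

theorem countMinimaDescents_succ (q m d : ℕ) (hq : 0 < q) (hqm : q ≤ m) :
    countMinimaDescents q (m + 1) d = (d + 1) * countMinimaDescents q m d +
      q * if d = 0 then 0 else countMinimaDescents q m (d - 1) := by
  classical
  have h1 : countMinimaDescents q (m + 1) d = ∑ σ : Perm (Fin m), ∑ p : Fin (m + 1),
      if DescentsAreMinima q (insertLast p σ) ∧ #(almostMinima q (insertLast p σ)) = d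
        then 1 else 0 := by
    rw [countMinimaDescents, Finset.card_filter, ← Fintype.sum_prod_type']
    exact (insertLast_bijective.sum_comp (fun τ : Perm (Fin (m + 1)) =>
      if DescentsAreMinima q τ ∧ #(almostMinima q τ) = d then 1 else 0)).symm
  have h2 : (if d = 0 then 0 else countMinimaDescents q m (d - 1)) =
      ∑ σ : Perm (Fin m), if DescentsAreMinima q σ ∧ #(almostMinima q σ) + 1 = d then 1 else 0 := by
    rcases d with _ | d
    · simp
    · simp [countMinimaDescents]
  rw [h1, h2, countMinimaDescents, Finset.card_filter, Finset.mul_sum, Finset.mul_sum,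
    ← Finset.sum_add_distrib]
  refine Finset.sum_congr rfl fun σ _ => ?_
  simp only [descentsAreMinima_insertLast_iff, card_almostMinima_insertLast q _ σ hq hqm]
  rw [Fin.sum_univ_castSucc]
  have hlast : ∀ i : Fin m, i.val ≠ m := fun i => i.isLt.ne
  have key : ∀ p : Fin m, (if (DescentsAreMinima q σ ∧
        ∀ i : Fin m, i.val = p.castSucc.val → q ≤ i.val → i ∈ almostMinima q σ) ∧
        #(almostMinima q σ) + (if p.castSucc.val < q then 1 else 0) = d then 1 else 0) =
      (if p.val < q then
        (if DescentsAreMinima q σ ∧ #(almostMinima q σ) + 1 = d then 1 else 0) else 0) +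
      (if p ∈ almostMinima q σ then
        (if DescentsAreMinima q σ ∧ #(almostMinima q σ) = d then 1 else 0) else 0) := by
    intro p
    have h3 : (∀ i : Fin m, i.val = p.castSucc.val → q ≤ i.val → i ∈ almostMinima q σ) ↔
        (q ≤ p.val → p ∈ almostMinima q σ) := by
      constructor
      · exact fun h => h p rfl
      · intro h i hi
        rw [show i = p from Fin.ext hi]
        exact h
    simp only [h3]
    have h4 : p ∈ almostMinima q σ → q ≤ p.val := fun h => by
      simp only [almostMinima, Finset.mem_filter] at h
      exact h.2.1
    simp only [Fin.val_castSucc]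
    by_cases hp : p.val < q
    · have h5 : p ∉ almostMinima q σ := fun h => by have := h4 h; omega
      simp [hp, h5, Nat.not_le.2 hp]
    · by_cases h5 : p ∈ almostMinima q σ <;> simp [hp, h5, Nat.not_lt.1 hp]
  have hcard : #{p : Fin m | p.val < q} = q := by
    rw [Fin.card_filter_val_lt]
    omega
  rw [Finset.sum_congr rfl fun p _ => key p, Finset.sum_add_distrib]
  have hsum : ∀ (t : Finset (Fin m)) (c : ℕ), (∑ p, if p ∈ t then c else 0) = #t * c :=
    fun t c => by simp
  have hsum' := hsum {p : Fin m | p.val < q}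
  simp only [Finset.mem_filter, Finset.mem_univ, true_and] at hsum'
  rw [hsum', hsum, hcard]
  simp only [Fin.val_last, hlast, false_imp_iff, implies_true, and_true, Nat.not_lt.2 hqm,
    if_false, add_zero]
  by_cases hd : DescentsAreMinima q σ ∧ #(almostMinima q σ) = d
  · simp only [hd.2, hd, and_self, if_true]
    ring
  · simp only [hd, if_false]
    ring

theorem countMinimaDescents_self (q d : ℕ) :
    countMinimaDescents q q d = if d = 0 then q.factorial else 0 := by
  classical
  have h1 : ∀ σ : Perm (Fin q), DescentsAreMinima q σ := fun σ i j _ h => by omega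
  have h2 : ∀ σ : Perm (Fin q), almostMinima q σ = ∅ := fun σ => by
    ext i
    simp [almostMinima]
  rcases d with _ | d <;> simp [countMinimaDescents, h1, h2, Fintype.card_perm]

theorem countMinimaDescents_add (q n d : ℕ) (hq : 0 < q) :
    countMinimaDescents q (q + n) d =
      (q - 1).factorial * q ^ (d + 1) * Nat.stirlingSecond (n + 1) (d + 1) := by
  induction n generalizing d with
  | zero =>
    rw [add_zero, countMinimaDescents_self]
    rcases d with _ | d
    · simp [← Nat.mul_factorial_pred hq.ne', mul_comm, Nat.stirlingSecond]
    · simp [Nat.stirlingSecond]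
  | succ n ih =>
    rw [← add_assoc, countMinimaDescents_succ q (q + n) d hq (by omega), ih,
      Nat.stirlingSecond_succ_succ (n + 1) d]
    rcases d with _ | d
    · simp
    · rw [if_neg (by omega), Nat.add_sub_cancel, ih]
      ring

end Equiv.Perm

namespace Finpartition

variable {α : Type*} [DecidableEq α] {s : Finset α} {a : α}

/-- Add a new point `a` to the block `B` of a partition of `s`, or as a new singleton block
if `B = ∅`. -/
def insertInto (P : Finpartition s) (ha : a ∉ s) (B : Finset α) (hB : B ∈ insert ∅ P.parts) :
    Finpartition (insert a s) :=
  have hBs : B ⊆ s := by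
    rcases Finset.mem_insert.1 hB with rfl | h
    · exact Finset.empty_subset s
    · exact P.subset h
  ofExistsUnique (insert (insert a B) (P.parts.erase B))
    (by
      intro p hp
      rcases Finset.mem_insert.1 hp with rfl | h
      · exact Finset.insert_subset_insert a hBs
      · exact (P.subset (Finset.mem_of_mem_erase h)).trans (Finset.subset_insert a s))
    (by
      intro x hx
      rcases Finset.mem_insert.1 hx with rfl | hxs
      · refine ⟨insert x B, by simp, ?_⟩
        rintro t ⟨ht, hxt⟩
        rcases Finset.mem_insert.1 ht with rfl | h
        · rfl
        · exact absurd (P.subset (Finset.mem_of_mem_erase h) hxt) ha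
      · have hxa : x ≠ a := fun h => ha (h ▸ hxs)
        by_cases hxB : x ∈ B
        · refine ⟨insert a B, by simp [hxB], ?_⟩
          rintro t ⟨ht, hxt⟩
          rcases Finset.mem_insert.1 ht with rfl | h
          · rfl
          · have hBP : B ∈ P.parts := by
              rcases Finset.mem_insert.1 hB with rfl | h
              · simp at hxB
              · exact h
            exact absurd (P.eq_of_mem_parts (Finset.mem_of_mem_erase h) hBP hxt hxB)
              (Finset.ne_of_mem_erase h)
        · obtain ⟨t, ht, hxt⟩ := P.exists_mem hxs
          refine ⟨t, ⟨by
            refine Finset.mem_insert_of_mem (Finset.mem_erase.2 ⟨?_, ht⟩)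
            rintro rfl
            exact hxB hxt, hxt⟩, ?_⟩
          rintro u ⟨hu, hxu⟩
          rcases Finset.mem_insert.1 hu with rfl | h
          · simp [hxa, hxB] at hxu
          · exact P.eq_of_mem_parts (Finset.mem_of_mem_erase h) ht hxu hxt)
    (by
      intro h
      rcases Finset.mem_insert.1 h with h | h
      · exact (Finset.insert_ne_empty a B) h.symm
      · exact P.empty_notMem_parts (Finset.mem_of_mem_erase h))

theorem parts_insertInto (P : Finpartition s) (ha : a ∉ s) (B : Finset α)
    (hB : B ∈ insert ∅ P.parts) :
    (P.insertInto ha B hB).parts = insert (insert a B) (P.parts.erase B) := rfl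

theorem insert_notMem_parts (P : Finpartition s) (ha : a ∉ s) (B : Finset α) :
    insert a B ∉ P.parts := fun h => ha (P.subset h (Finset.mem_insert_self a B))

theorem card_parts_insertInto (P : Finpartition s) (ha : a ∉ s) (B : Finset α)
    (hB : B ∈ insert ∅ P.parts) :
    #(P.insertInto ha B hB).parts = #P.parts + if B = ∅ then 1 else 0 := by
  rw [parts_insertInto, Finset.card_insert_of_notMem
    (fun h => P.insert_notMem_parts ha B (Finset.mem_of_mem_erase h))]
  split_ifs with h
  · rw [h, Finset.erase_eq_of_notMem P.empty_notMem_parts]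
  · have hBP : B ∈ P.parts := by simpa [h] using hB
    exact Finset.card_erase_add_one hBP

theorem insertInto_injective (ha : a ∉ s) {P Q : Finpartition s} {B C : Finset α}
    {hB : B ∈ insert ∅ P.parts} {hC : C ∈ insert ∅ Q.parts}
    (h : P.insertInto ha B hB = Q.insertInto ha C hC) : P = Q ∧ B = C := by
  have hp : insert (insert a B) (P.parts.erase B) = insert (insert a C) (Q.parts.erase C) := by
    rw [← parts_insertInto P ha B hB, h, parts_insertInto]
  have haB : a ∉ B := by
    rcases Finset.mem_insert.1 hB with rfl | h
    · simp
    · exact fun h' => ha (P.subset h h')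
  have haC : a ∉ C := by
    rcases Finset.mem_insert.1 hC with rfl | h
    · simp
    · exact fun h' => ha (Q.subset h h')
  have hBC : B = C := by
    have hm : insert a B ∈ insert (insert a C) (Q.parts.erase C) :=
      hp ▸ Finset.mem_insert_self _ _
    rcases Finset.mem_insert.1 hm with h | h
    · rw [← Finset.erase_insert haB, h, Finset.erase_insert haC]
    · exact absurd (Finset.mem_of_mem_erase h) (Q.insert_notMem_parts ha B)
  subst hBC
  refine ⟨?_, rfl⟩
  have he : P.parts.erase B = Q.parts.erase B := by
    rw [← Finset.erase_insert (s := P.parts.erase B)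
      (fun h => P.insert_notMem_parts ha B (Finset.mem_of_mem_erase h)), hp,
      Finset.erase_insert (fun h => Q.insert_notMem_parts ha B (Finset.mem_of_mem_erase h))]
  ext1
  by_cases h : B = ∅
  · rwa [h, Finset.erase_eq_of_notMem P.empty_notMem_parts,
      Finset.erase_eq_of_notMem Q.empty_notMem_parts] at he
  · have h1 : B ∈ P.parts := by simpa [h] using hB
    have h2 : B ∈ Q.parts := by simpa [h] using hC
    rw [← Finset.insert_erase h1, he, Finset.insert_erase h2]

theorem exists_insertInto_eq (ha : a ∉ s) (R : Finpartition (insert a s)) :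
    ∃ (P : Finpartition s) (B : Finset α) (hB : B ∈ insert ∅ P.parts),
      P.insertInto ha B hB = R := by
  obtain ⟨A, hA, haA⟩ := R.exists_mem (Finset.mem_insert_self a s)
  have hAs : A.erase a ⊆ s := by
    intro x hx
    have := R.subset hA (Finset.mem_of_mem_erase hx)
    simpa [Finset.ne_of_mem_erase hx] using this
  have hne : ∀ t ∈ R.parts.erase A, a ∉ t := fun t ht hat =>
    Finset.ne_of_mem_erase ht (R.eq_of_mem_parts (Finset.mem_of_mem_erase ht) hA hat haA)
  let P : Finpartition s := ofExistsUnique ((insert (A.erase a) (R.parts.erase A)).erase ∅)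
    (by
      intro p hp
      rcases Finset.mem_insert.1 (Finset.mem_of_mem_erase hp) with rfl | h
      · exact hAs
      · intro x hx
        have hxa : x ≠ a := by rintro rfl; exact hne p h hx
        simpa [hxa] using R.subset (Finset.mem_of_mem_erase h) hx)
    (by
      intro x hx
      have hxa : x ≠ a := by rintro rfl; exact ha hx
      obtain ⟨t, ht, hxt⟩ := R.exists_mem (Finset.mem_insert_of_mem hx)
      by_cases htA : t = A
      · subst htA
        refine ⟨t.erase a, ⟨?_, by simp [hxa, hxt]⟩, ?_⟩
        · refine Finset.mem_erase.2 ⟨?_, by simp⟩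
          exact Finset.ne_empty_of_mem (Finset.mem_erase.2 ⟨hxa, hxt⟩)
        · rintro u ⟨hu, hxu⟩
          rcases Finset.mem_insert.1 (Finset.mem_of_mem_erase hu) with rfl | h
          · rfl
          · exact absurd (R.eq_of_mem_parts (Finset.mem_of_mem_erase h) ht hxu hxt)
              (Finset.ne_of_mem_erase h)
      · refine ⟨t, ⟨?_, hxt⟩, ?_⟩
        · refine Finset.mem_erase.2 ⟨Finset.ne_empty_of_mem hxt, ?_⟩
          exact Finset.mem_insert_of_mem (Finset.mem_erase.2 ⟨htA, ht⟩)
        · rintro u ⟨hu, hxu⟩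
          rcases Finset.mem_insert.1 (Finset.mem_of_mem_erase hu) with rfl | h
          · exact absurd (R.eq_of_mem_parts ht hA hxt (Finset.mem_of_mem_erase hxu)) htA
          · exact R.eq_of_mem_parts (Finset.mem_of_mem_erase h) ht hxu hxt)
    (by simp)
  have hP : P.parts = (insert (A.erase a) (R.parts.erase A)).erase ∅ := rfl
  have hB : A.erase a ∈ insert ∅ P.parts := by
    by_cases h : A.erase a = ∅
    · rw [h]; exact Finset.mem_insert_self _ _
    · exact Finset.mem_insert_of_mem (by rw [hP]; simp [h])
  refine ⟨P, A.erase a, hB, ?_⟩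
  ext1
  have hR : ∅ ∉ R.parts.erase A := fun h => R.empty_notMem_parts (Finset.mem_of_mem_erase h)
  have hBR : A.erase a ∉ R.parts.erase A := by
    intro h
    obtain ⟨x, hx⟩ := R.nonempty_of_mem_parts (Finset.mem_of_mem_erase h)
    exact Finset.ne_of_mem_erase h (R.eq_of_mem_parts (Finset.mem_of_mem_erase h) hA hx
      (Finset.mem_of_mem_erase hx))
  rw [parts_insertInto, hP, Finset.insert_erase haA, Finset.erase_right_comm,
    Finset.erase_insert hBR, Finset.erase_eq_of_notMem hR, Finset.insert_erase hA]

theorem card_filter_card_parts_insert (ha : a ∉ s) (k : ℕ) :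
    #{R : Finpartition (insert a s) | #R.parts = k} =
      k * #{P : Finpartition s | #P.parts = k} + #{P : Finpartition s | #P.parts + 1 = k} := by
  have h1 : #{R : Finpartition (insert a s) | #R.parts = k} =
      ∑ x ∈ (univ : Finset (Finpartition s)).sigma (fun P => insert ∅ P.parts),
        if #x.1.parts + (if x.2 = ∅ then 1 else 0) = k then 1 else 0 := by
    rw [Finset.card_filter]
    symm
    refine Finset.sum_bij
      (fun x hx => x.1.insertInto ha x.2 (Finset.mem_sigma.1 hx).2)
      (fun _ _ => Finset.mem_univ _) ?_ ?_ ?_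
    · rintro ⟨P, B⟩ hx ⟨Q, C⟩ hy h
      obtain ⟨rfl, rfl⟩ := insertInto_injective ha h
      rfl
    · intro R _
      obtain ⟨P, B, hB, h⟩ := exists_insertInto_eq ha R
      exact ⟨⟨P, B⟩, by simpa using hB, h⟩
    · rintro ⟨P, B⟩ hx
      simp only [card_parts_insertInto]
  rw [h1, Finset.sum_sigma, Finset.card_filter, Finset.card_filter, Finset.mul_sum,
    ← Finset.sum_add_distrib]
  refine Finset.sum_congr rfl fun P _ => ?_
  rw [Finset.sum_insert P.empty_notMem_parts, Finset.sum_congr rfl (g := fun _ =>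
    if #P.parts = k then 1 else 0)
    (fun B hB => by simp [P.ne_empty hB])]
  simp only [Finset.sum_const, smul_eq_mul, if_true]
  split_ifs <;> simp_all

theorem card_filter_card_parts (s : Finset α) (k : ℕ) :
    #{P : Finpartition s | #P.parts = k} = Nat.stirlingSecond #s k := by
  induction s using Finset.induction_on generalizing k with
  | empty =>
    rcases k with _ | k
    · have : ∀ P : Finpartition (∅ : Finset α), #P.parts = 0 := fun P =>
        Nat.le_zero.1 P.card_parts_le_card
      have h1 : Fintype.card (Finpartition (∅ : Finset α)) = 1 := by
        change Fintype.card (Finpartition (⊥ : Finset α)) = 1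
        exact Fintype.card_eq_one_iff_nonempty_unique.2 ⟨inferInstance⟩
      simp [this, h1]
    · have : ∀ P : Finpartition (∅ : Finset α), #P.parts = 0 := fun P =>
        Nat.le_zero.1 P.card_parts_le_card
      simp [this]
  | insert a s ha ih =>
    rw [card_filter_card_parts_insert ha, Finset.card_insert_of_notMem ha]
    rcases k with _ | k
    · simp
    · simp only [Nat.add_right_cancel_iff, ih, Nat.stirlingSecond_succ_succ]

end Finpartition

theorem stirling2_eq_stirlingSecond (n k : ℕ) : stirling2 n k = Nat.stirlingSecond n k := by
  rw [stirling2, Nat.card_eq_fintype_card, Fintype.card_subtype,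
    Finpartition.card_filter_card_parts, Finset.card_univ, Fintype.card_fin]

section natPerm

open Equiv.Perm

variable {m : ℕ}

theorem natPerm_val_add_one (σ : Equiv.Perm (Fin m)) (i : Fin m) :
    natPerm σ (i.val + 1) = (σ i).val + 1 :=
  Equiv.Perm.extendDomain_apply_image σ (finIccEquiv m) i

theorem card_filter_natPerm_lt (σ : Equiv.Perm (Fin m)) (i : Fin m) :
    #{j ∈ Finset.Ico 1 (i.val + 1) | natPerm σ j < natPerm σ (i.val + 1)} =
      σ.numSmallerBefore i := by
  symm
  refine Finset.card_bij (fun j _ => j.val + 1) ?_ ?_ ?_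
  · intro j hj
    simp only [Finset.mem_filter, Finset.mem_univ, true_and, Fin.lt_def] at hj
    simp only [Finset.mem_filter, Finset.mem_Ico, natPerm_val_add_one]
    omega
  · intro j _ k _ h
    exact Fin.ext (by omega)
  · intro b hb
    simp only [Finset.mem_filter, Finset.mem_Ico] at hb
    obtain ⟨c, rfl⟩ : ∃ c, b = c + 1 := ⟨b - 1, by omega⟩
    have hc : c < m := by have := i.isLt; omega
    have h := natPerm_val_add_one σ ⟨c, hc⟩
    simp only at h
    rw [h, natPerm_val_add_one] at hb
    refine ⟨⟨c, hc⟩, ?_, rfl⟩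
    simp only [Finset.mem_filter, Finset.mem_univ, true_and, Fin.lt_def]
    omega

theorem val_add_one_mem_DelQ {q : ℕ} (hq : 0 < q) (σ : Equiv.Perm (Fin m)) (i : Fin m) :
    i.val + 1 ∈ DelQ q m (natPerm σ) ↔ i ∈ almostMinima q σ := by
  have := i.isLt
  simp only [DelQ, almostMinima, Finset.mem_filter, Finset.mem_Icc, card_filter_natPerm_lt,
    Finset.mem_univ, true_and]
  omega

theorem DelQ_natPerm {q : ℕ} (hq : 0 < q) (σ : Equiv.Perm (Fin m)) :
    DelQ q m (natPerm σ) = (almostMinima q σ).image fun i => i.val + 1 := by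
  ext b
  rw [Finset.mem_image]
  constructor
  · intro hb
    have h := hb
    simp only [DelQ, Finset.mem_filter, Finset.mem_Icc] at h
    obtain ⟨c, rfl⟩ : ∃ c, b = c + 1 := ⟨b - 1, by omega⟩
    exact ⟨⟨c, by omega⟩, (val_add_one_mem_DelQ hq σ ⟨c, by omega⟩).1 hb, rfl⟩
  · rintro ⟨i, hi, rfl⟩
    exact (val_add_one_mem_DelQ hq σ i).2 hi

theorem card_DelQ_natPerm {q : ℕ} (hq : 0 < q) (σ : Equiv.Perm (Fin m)) :
    #(DelQ q m (natPerm σ)) = #(almostMinima q σ) := by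
  rw [DelQ_natPerm hq]
  exact Finset.card_image_of_injective _ fun i j h => Fin.ext (by simpa using h)

theorem image_DelQ_eq_DesQ_iff {q : ℕ} (hq : 0 < q) (σ : Equiv.Perm (Fin m)) :
    (DelQ q m (natPerm σ)).image (fun i => i - 1) = DesQ q m (natPerm σ) ↔
      DescentsAreMinima q σ := by
  rw [DesQ, eq_comm, Finset.union_eq_right, DelQ_natPerm hq, Finset.image_image]
  constructor
  · intro h i j hij hqj hd
    have hi : i.val + 1 ∈ DesSet m (natPerm σ) ∩ Finset.Icc q (m - 1) := by
      have h1 := natPerm_val_add_one σ i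
      have h2 := natPerm_val_add_one σ j
      rw [← hij] at h2
      have := j.isLt
      simp only [DesSet, Finset.mem_inter, Finset.mem_filter, Finset.mem_Icc, h1, h2]
      rw [Fin.lt_def] at hd
      omega
    obtain ⟨l, hl, hli⟩ := Finset.mem_image.1 (h hi)
    obtain rfl : l = j := Fin.ext (by simp at hli; omega)
    simp only [almostMinima, Finset.mem_filter] at hl
    exact hl.2.2
  · intro h b hb
    simp only [DesSet, Finset.mem_inter, Finset.mem_filter, Finset.mem_Icc] at hb
    obtain ⟨c, rfl⟩ : ∃ c, b = c + 1 := ⟨b - 1, by omega⟩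
    have h1 := natPerm_val_add_one σ ⟨c, by omega⟩
    have h2 := natPerm_val_add_one σ ⟨c + 1, by omega⟩
    simp only at h1 h2
    rw [h1, h2] at hb
    refine Finset.mem_image.2 ⟨⟨c + 1, by omega⟩, ?_, by simp⟩
    simp only [almostMinima, Finset.mem_filter, Finset.mem_univ, true_and]
    exact ⟨hb.2.1, h ⟨c, by omega⟩ ⟨c + 1, by omega⟩ rfl hb.2.1 (by rw [Fin.lt_def]; omega)⟩

end natPerm

/-- For all positive integers `q`, `n` and every integer `k ≥ 1`,
`#{σ ∈ S_{n+q-1} : Del_q(σ) - 1 = Des_q(σ) and #Del_q(σ) = k-1} = (q-1)! · q^k · S(n,k)`. -/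
theorem refined_count (q n k : ℕ) (hq : 0 < q) (hn : 0 < n) (hk : 1 ≤ k) :
    {σ : Equiv.Perm (Fin (n + q - 1)) |
        (DelQ q (n + q - 1) (natPerm σ)).image (fun i => i - 1) =
          DesQ q (n + q - 1) (natPerm σ) ∧
        (DelQ q (n + q - 1) (natPerm σ)).card = k - 1}.ncard =
      Nat.factorial (q - 1) * q ^ k * stirling2 n k := by
  classical
  obtain ⟨n, rfl⟩ : ∃ l, n = l + 1 := ⟨n - 1, by omega⟩
  obtain ⟨k, rfl⟩ : ∃ l, k = l + 1 := ⟨k - 1, by omega⟩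
  simp only [image_DelQ_eq_DesQ_iff hq, card_DelQ_natPerm hq, Nat.add_sub_cancel]
  rw [stirling2_eq_stirlingSecond, ← Equiv.Perm.countMinimaDescents_add q n k hq,
    show n + 1 + q - 1 = q + n by omega, Equiv.Perm.countMinimaDescents,
    ← Set.ncard_coe_finset, Finset.coe_filter_univ]
end

section
/- For all positive integers q and n, q · Σ_{σ ∈ S_{n+q−1}, Del_q(σ)−1 = Des_q(σ)} q^{#Del_q(σ)} = (q−1)! · Σ_k q^{2k} S(n,k) = (q−1)! · b_{q²}(n). -/
open Finset

/-- The Touchard polynomials evaluated at `x`, through the binomial recurrence. -/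
def touchard (x : ℕ) : ℕ → ℕ
  | 0 => 1
  | n + 1 => x * ∑ i : Fin (n + 1), n.choose i * touchard x i

theorem touchard_succ (x n : ℕ) :
    touchard x (n + 1) = x * ∑ i ∈ range (n + 1), n.choose i * touchard x i := by
  rw [touchard, Finset.sum_range]

/-- Partitions of `s` in which `a` lies in the block `s \ U` correspond to partitions of `U`. -/
theorem sum_finpartition_part_eq {α : Type*} [DecidableEq α] (x : ℕ) {s U : Finset α} {a : α}
    (has : a ∈ s) (hU : U ⊆ s) (haU : a ∉ U) :
    ∑ P : Finpartition s with s \ P.part a = U, x ^ P.parts.card =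
      x * ∑ P : Finpartition U, x ^ P.parts.card := by
  have haT : a ∈ s \ U := by simp [has, haU]
  have hdisj : Disjoint U (s \ U) := disjoint_sdiff
  have hpart (P : Finpartition s) (h : s \ P.part a = U) : P.part a = s \ U := by
    rw [← h, Finset.sdiff_sdiff_eq_self (P.part_subset a)]
  have hmem (P : Finpartition s) (h : s \ P.part a = U) : s \ U ∈ P.parts := by
    rw [← hpart P h]; exact P.part_mem.2 has
  have hnot (P : Finpartition U) : s \ U ∉ P.parts := fun h => haU (P.le h haT)
  rw [mul_sum]
  refine sum_bij' (i := fun P hP => (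
      { parts := P.parts.erase (s \ U)
        supIndep := P.supIndep.subset (erase_subset _ _)
        sup_parts := ?_
        bot_notMem := fun h => P.bot_notMem (mem_of_mem_erase h) } : Finpartition U))
    (j := fun P _ => P.extend (b := s \ U) (c := s) (ne_of_mem_of_not_mem' haT (by simp))
      hdisj (by simpa using hU)) ?_ ?_ ?_ ?_ ?_
  · have h := hmem P (mem_filter.1 hP).2
    ext b
    simp only [mem_sup, mem_erase, id]
    constructor
    · rintro ⟨t, ⟨hne, ht⟩, hb⟩
      by_contra hbU
      exact hne (P.eq_of_mem_parts ht h hb (by simp [hbU, P.le ht hb]))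
    · intro hb
      obtain ⟨t, ht, hbt⟩ := P.exists_mem (hU hb)
      refine ⟨t, ⟨?_, ht⟩, hbt⟩
      rintro rfl
      exact (mem_sdiff.1 hbt).2 hb
  · simp
  · intro P _
    have h : (P.extend (b := s \ U) (c := s) (ne_of_mem_of_not_mem' haT (by simp))
      hdisj (by simpa using hU)).part a = s \ U :=
      Finpartition.part_eq_of_mem _ (by simp) haT
    simp only [mem_filter, mem_univ, true_and]
    rw [h, Finset.sdiff_sdiff_eq_self hU]
  · intro P hP
    ext1
    simp [insert_erase (hmem P (mem_filter.1 hP).2)]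
  · intro P _
    ext1
    simp [erase_insert (hnot P)]
  · intro P hP
    have h := hmem P (mem_filter.1 hP).2
    rw [← pow_succ', card_erase_add_one h]

theorem sum_finpartition_insert {α : Type*} [DecidableEq α] (x : ℕ) {s : Finset α} {a : α}
    (ha : a ∉ s) :
    ∑ P : Finpartition (insert a s), x ^ P.parts.card =
      x * ∑ U ∈ s.powerset, ∑ P : Finpartition U, x ^ P.parts.card := by
  rw [mul_sum, ← sum_fiberwise_of_maps_to
    (g := fun P : Finpartition (insert a s) => insert a s \ P.part a) (t := s.powerset)]
  · refine sum_congr rfl fun U hU => ?_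
    have hU := mem_powerset.1 hU
    exact sum_finpartition_part_eq x (mem_insert_self a s) (hU.trans (subset_insert a s))
      fun h => ha (hU h)
  · intro P _
    have : a ∈ P.part a := P.mem_part_self.2 (mem_insert_self a s)
    grind

theorem sum_finpartition_eq_touchard {α : Type*} [DecidableEq α] (x : ℕ) (s : Finset α) :
    ∑ P : Finpartition s, x ^ P.parts.card = touchard x s.card := by
  induction s using Finset.strongInduction with
  | H s ih =>
    obtain rfl | ⟨a, ha⟩ := s.eq_empty_or_nonempty
    · have h (P : Finpartition (∅ : Finset α)) : P.parts = ∅ := P.parts_eq_empty_iff.2 rfl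
      have hc : Fintype.card (Finpartition (∅ : Finset α)) = 1 :=
        Fintype.card_eq_one_iff.2 ⟨⊥, fun P => by ext1; rw [h, h]⟩
      simp [h, hc, touchard]
    · have hlt : s.erase a ⊂ s := erase_ssubset ha
      rw [← insert_erase ha, sum_finpartition_insert x (notMem_erase a s),
        card_insert_of_notMem (notMem_erase a s), touchard_succ,
        sum_congr rfl fun U hU => ih U ((mem_powerset.1 hU).trans_ssubset hlt),
        sum_powerset_apply_card]
      simp

theorem qBell_eq_touchard (x n : ℕ) : qBell x n = touchard x n := by
  have h := sum_finpartition_eq_touchard x (univ : Finset (Fin n))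
  rw [card_univ, Fintype.card_fin] at h
  rw [← h, qBell, ← sum_fiberwise_of_maps_to
    (g := fun P : Finpartition (univ : Finset (Fin n)) => P.parts.card) (t := range (n + 1))]
  · refine sum_congr rfl fun k _ => ?_
    rw [sum_congr rfl fun P hP => by rw [(mem_filter.1 hP).2], sum_const, stirling2,
      Nat.card_eq_fintype_card, Fintype.card_subtype, smul_eq_mul, mul_comm]
  · intro P _
    have := P.card_parts_le_card
    simp at this ⊢
    omega

open Classical in
/-- Inversion codes of length `m`: functions supported on `{1,…,m}` with `c i < i` there. -/
noncomputable def invCodes : ℕ → Finset (ℕ → ℕ)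
  | 0 => {0}
  | m + 1 => (invCodes m ×ˢ range (m + 1)).image fun p => Function.update p.1 (m + 1) p.2

theorem mem_invCodes {m : ℕ} {c : ℕ → ℕ} :
    c ∈ invCodes m ↔ (∀ i ∈ Icc 1 m, c i < i) ∧ ∀ i ∉ Icc 1 m, c i = 0 := by
  induction m generalizing c with
  | zero => simp [invCodes, funext_iff]
  | succ m ih =>
    simp only [invCodes, mem_image, mem_product, Prod.exists, ih, mem_Icc, mem_range]
    constructor
    · rintro ⟨c, v, ⟨⟨h1, h2⟩, hv⟩, rfl⟩
      constructor <;> intro i hi <;> by_cases him : i = m + 1 <;>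
        simp only [Function.update_apply, him, if_true, if_false] <;> grind
    · rintro ⟨h1, h2⟩
      refine ⟨Function.update c (m + 1) 0, c (m + 1), ⟨⟨?_, ?_⟩, ?_⟩, by simp⟩ <;>
        grind [Function.update_apply]

theorem sum_invCodes_succ (m : ℕ) (f : (ℕ → ℕ) → ℕ) :
    ∑ c ∈ invCodes (m + 1), f c =
      ∑ c ∈ invCodes m, ∑ v ∈ range (m + 1), f (Function.update c (m + 1) v) := by
  classical
  rw [invCodes, sum_image, sum_product]
  rintro ⟨c, v⟩ h ⟨c', v'⟩ h' heq
  simp only [mem_coe, mem_product, mem_invCodes] at h h'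
  have hv : v = v' := by simpa using congrFun heq (m + 1)
  have hc : c = c' := by
    funext i
    have := congrFun heq i
    grind [Function.update_apply]
  rw [hv, hc]

theorem card_invCodes (m : ℕ) : (invCodes m).card = m.factorial := by
  induction m with
  | zero => simp [invCodes]
  | succ m ih =>
    rw [card_eq_sum_ones, sum_invCodes_succ]
    simp [ih, Nat.factorial_succ, mul_comm]

/-- The number of earlier entries of `p` (from position `1` on) smaller than the one at `i`. -/
def smallerBefore (p : ℕ → ℕ) (i : ℕ) : ℕ := ((Ico 1 i).filter fun j => p j < p i).card

theorem smallerBefore_lt (p : ℕ → ℕ) {i : ℕ} (hi : 1 ≤ i) : smallerBefore p i < i := by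
  have := card_filter_le (Ico 1 i) fun j => p j < p i
  rw [Nat.card_Ico] at this
  unfold smallerBefore
  omega

theorem smallerBefore_succ_le_iff {p : ℕ → ℕ} (hp : p.Injective) {i : ℕ} (hi : 1 ≤ i) :
    smallerBefore p (i + 1) ≤ smallerBefore p i ↔ p (i + 1) < p i := by
  have hne : p (i + 1) ≠ p i := fun h => by simpa using hp h
  constructor
  · contrapose!
    intro h
    refine card_lt_card ((ssubset_iff_of_subset ?_).2 ⟨i, ?_, ?_⟩)
    · intro j; simp only [mem_filter, mem_Ico]; omega
    · simp only [mem_filter, mem_Ico]; omega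
    · simp
  · intro h
    refine card_le_card fun j => ?_
    simp only [mem_filter, mem_Ico]
    intro hj
    have : j ≠ i := by rintro rfl; omega
    omega

theorem lt_iff_lt_of_smallerBefore_eq {p s : ℕ → ℕ} (hs : s.Injective)
    (h : ∀ i, smallerBefore p i = smallerBefore s i) (i : ℕ) :
    ∀ j, 1 ≤ j → j < i → (p j < p i ↔ s j < s i) := by
  induction i using Nat.strong_induction_on with
  | _ i ih =>
    have hlt : ∀ j k, 1 ≤ j → j < i → 1 ≤ k → k < i → p j < p k → s j < s k := by
      intro j k hj hji hk hki hjk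
      rcases lt_trichotomy j k with hl | rfl | hl
      · exact (ih k hki j hj hl).1 hjk
      · omega
      · have h1 := ih j hji k hk hl
        have h2 : s j ≠ s k := fun e => by have := hs e; omega
        omega
    have hsub : (Ico 1 i).filter (fun j => p j < p i) = (Ico 1 i).filter fun j => s j < s i := by
      by_cases hps : (Ico 1 i).filter (fun j => p j < p i) ⊆ (Ico 1 i).filter fun j => s j < s i
      · exact eq_of_subset_of_card_le hps (h i).ge
      · symm
        refine eq_of_subset_of_card_le ?_ (h i).le
        obtain ⟨j, hj, hj'⟩ := not_subset.1 hps
        intro k hk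
        by_contra hk'
        simp only [mem_filter, mem_Ico] at hj hj' hk hk'
        have := hlt j k (by omega) (by omega) (by omega) (by omega) (by omega)
        omega
    intro j hj hji
    have := congrArg (j ∈ ·) hsub
    simpa [hj, hji] using this

theorem eq_of_smallerBefore_eq {p s : Equiv.Perm ℕ} (hp0 : p 0 = 0) (hs0 : s 0 = 0)
    (h : ∀ i, smallerBefore p i = smallerBefore s i) : p = s := by
  have key := lt_iff_lt_of_smallerBefore_eq s.injective h
  have hmono : ∀ i j, p i < p j → s i < s j := by
    intro i j hij
    have hj : j ≠ 0 := by rintro rfl; omega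
    have hne : s i ≠ s j := fun e => by have := s.injective e; subst this; omega
    have hj0 : s j ≠ s 0 := fun e => hj (s.injective e)
    rcases Nat.eq_zero_or_pos i with rfl | hi
    · omega
    rcases lt_trichotomy i j with hl | rfl | hl
    · exact (key j i hi hl).1 hij
    · omega
    · have := key i j (by omega) hl
      omega
  have hle : StrictMono (p.symm.trans s) := fun a b hab => hmono _ _ (by simpa using hab)
  have hid : ∀ a, p.symm.trans s a = a := by
    have := Subsingleton.elim (hle.orderIsoOfSurjective _ (Equiv.surjective _)) (OrderIso.refl ℕ)
    intro a
    exact congrArg (fun e : ℕ ≃o ℕ => e a) this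
  ext i
  simpa using (hid (p i)).symm

theorem natPerm_apply_of_notMem {m : ℕ} (σ : Equiv.Perm (Fin m)) {i : ℕ} (hi : i ∉ Icc 1 m) :
    natPerm σ i = i :=
  Equiv.Perm.extendDomain_apply_not_subtype _ _ hi

theorem natPerm_mem {m : ℕ} (σ : Equiv.Perm (Fin m)) {i : ℕ} (hi : i ∈ Icc 1 m) :
    natPerm σ i ∈ Icc 1 m := by
  by_contra h
  have := (natPerm σ).injective (natPerm_apply_of_notMem σ h)
  rw [this] at h
  exact h hi

theorem natPerm_injective (m : ℕ) : Function.Injective (natPerm (m := m)) :=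
  Equiv.Perm.extendDomainHom_injective (finIccEquiv m)

/-- The inversion code of a permutation of `{1,…,m}`. -/
def invCode (m : ℕ) (p : ℕ → ℕ) (i : ℕ) : ℕ := if i ≤ m then smallerBefore p i else 0

theorem invCode_natPerm_mem {m : ℕ} (σ : Equiv.Perm (Fin m)) :
    invCode m (natPerm σ) ∈ invCodes m := by
  rw [mem_invCodes]
  refine ⟨fun i hi => ?_, fun i hi => ?_⟩
  · rw [mem_Icc] at hi
    rw [invCode, if_pos hi.2]
    exact smallerBefore_lt _ hi.1
  · rw [mem_Icc] at hi
    unfold invCode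
    split_ifs
    · obtain rfl : i = 0 := by omega
      simp [smallerBefore]
    · rfl

theorem invCode_natPerm_injective (m : ℕ) :
    Function.Injective fun σ : Equiv.Perm (Fin m) => invCode m (natPerm σ) := by
  intro σ τ h
  refine natPerm_injective m (eq_of_smallerBefore_eq
    (natPerm_apply_of_notMem σ (by simp)) (natPerm_apply_of_notMem τ (by simp)) fun i => ?_)
  by_cases hi : i ≤ m
  · simpa [invCode, hi] using congrFun h i
  · have hout (ρ : Equiv.Perm (Fin m)) : smallerBefore (natPerm ρ) i = (Ico 1 i).card := by
      rw [smallerBefore, filter_true_of_mem]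
      intro j hj
      rw [natPerm_apply_of_notMem ρ (i := i) (by simp; omega)]
      by_cases hjm : j ∈ Icc 1 m
      · have := natPerm_mem ρ hjm
        simp only [mem_Icc] at this
        omega
      · rw [natPerm_apply_of_notMem ρ hjm]
        exact (mem_Ico.1 hj).2
    rw [hout, hout]

theorem sum_invCode (m : ℕ) (f : (ℕ → ℕ) → ℕ) :
    ∑ σ : Equiv.Perm (Fin m), f (invCode m (natPerm σ)) = ∑ c ∈ invCodes m, f c := by
  classical
  have himg : univ.image (fun σ : Equiv.Perm (Fin m) => invCode m (natPerm σ)) = invCodes m := by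
    refine eq_of_subset_of_card_le ?_ ?_
    · intro c hc
      obtain ⟨σ, -, rfl⟩ := mem_image.1 hc
      exact invCode_natPerm_mem σ
    · rw [card_image_of_injective _ (invCode_natPerm_injective m), card_invCodes, card_univ,
        Fintype.card_perm, Fintype.card_fin]
  rw [← himg, sum_image (invCode_natPerm_injective m).injOn]

theorem sum_range_choose_right (d k : ℕ) :
    ∑ e ∈ range d, e.choose k = d.choose (k + 1) := by
  induction d with
  | zero => simp
  | succ d ih => rw [sum_range_succ, ih, Nat.choose_succ_succ', add_comm]

/-- The contribution of two consecutive code entries `u`, `v`. -/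
def stepWeight (q u v : ℕ) : ℕ := if v < q then q else if u < v then 1 else 0

theorem ite_pow_card_DelQ_eq_prod {q m : ℕ} (hq : 0 < q) (σ : Equiv.Perm (Fin m)) :
    (if (DelQ q m (natPerm σ)).image (fun i => i - 1) = DesQ q m (natPerm σ) then
        q ^ (DelQ q m (natPerm σ)).card else 0) =
      ∏ i ∈ Ico q m,
        stepWeight q (invCode m (natPerm σ) i) (invCode m (natPerm σ) (i + 1)) := by
  set p := natPerm σ
  have hcode : ∀ i ≤ m, invCode m p i = smallerBefore p i := fun i hi => by simp [invCode, hi]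
  have hdel : DelQ q m p =
      ((Ico q m).filter fun i => smallerBefore p (i + 1) < q).image (· + 1) := by
    ext i
    simp only [DelQ, ← smallerBefore.eq_1, mem_filter, mem_Icc, mem_image, mem_Ico]
    constructor
    · rintro ⟨⟨h1, h2⟩, h3⟩
      refine ⟨i - 1, ?_, by omega⟩
      rw [show i - 1 + 1 = i by omega]
      omega
    · rintro ⟨j, hj, rfl⟩
      omega
  have hcond : (DelQ q m p).image (fun i => i - 1) = DesQ q m p ↔
      ∀ i ∈ Ico q m, ¬ smallerBefore p (i + 1) < q → smallerBefore p i < smallerBefore p (i + 1) := by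
    rw [DesQ, eq_comm, union_eq_right, hdel, image_image]
    simp only [Function.comp_def, Nat.add_sub_cancel, image_id']
    constructor
    · intro h i hi hnot
      by_contra hle
      rw [not_lt, smallerBefore_succ_le_iff p.injective (by grind)] at hle
      have : i ∈ DesSet m p ∩ Icc q (m - 1) := by
        simp only [DesSet, mem_inter, mem_filter, mem_Icc]
        rw [mem_Ico] at hi
        omega
      exact hnot (mem_filter.1 (h this)).2
    · intro h i hi
      simp only [DesSet, mem_inter, mem_filter, mem_Icc] at hi
      have hi' : i ∈ Ico q m := by rw [mem_Ico]; omega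
      refine mem_filter.2 ⟨hi', ?_⟩
      by_contra hnot
      have h1 := h i hi' hnot
      have h2 := (smallerBefore_succ_le_iff p.injective hi.1.1.1).2 hi.1.2
      omega
  have hprod : ∏ i ∈ Ico q m, stepWeight q (invCode m p i) (invCode m p (i + 1)) =
      ∏ i ∈ Ico q m, stepWeight q (smallerBefore p i) (smallerBefore p (i + 1)) :=
    prod_congr rfl fun i hi => by
      rw [mem_Ico] at hi
      rw [hcode i (by omega), hcode (i + 1) (by omega)]
  rw [hprod]
  split_ifs with h
  · rw [hcond] at h
    rw [hdel, card_image_of_injective _ (add_left_injective 1), ← prod_const, prod_filter]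
    refine prod_congr rfl fun i hi => ?_
    have := h i hi
    unfold stepWeight
    split_ifs <;> first | rfl | omega
  · rw [hcond] at h
    push Not at h
    obtain ⟨i, hi, h1, h2⟩ := h
    refine (prod_eq_zero hi ?_).symm
    unfold stepWeight
    rw [if_neg (by omega), if_neg (by omega)]

/-- The weighted sum over inversion codes of length `m` of a function of the last entry. -/
noncomputable def codeSum (q m : ℕ) (f : ℕ → ℕ) : ℕ :=
  ∑ c ∈ invCodes m, (∏ i ∈ Ico q m, stepWeight q (c i) (c (i + 1))) * f (c m)

theorem codeSum_succ {q m : ℕ} (hqm : q ≤ m) (f : ℕ → ℕ) :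
    codeSum q (m + 1) f =
      codeSum q m fun u => ∑ v ∈ range (m + 1), stepWeight q u v * f v := by
  rw [codeSum, codeSum, sum_invCodes_succ]
  refine sum_congr rfl fun c _ => ?_
  rw [mul_sum]
  refine sum_congr rfl fun v _ => ?_
  rw [prod_Ico_succ_top hqm, mul_assoc]
  congr 1
  · refine prod_congr rfl fun i hi => ?_
    rw [mem_Ico] at hi
    rw [Function.update_of_ne (by omega), Function.update_of_ne (by omega)]
  · simp

theorem codeSum_congr {q m : ℕ} (hm : 0 < m) {f g : ℕ → ℕ} (h : ∀ u < m, f u = g u) :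
    codeSum q m f = codeSum q m g :=
  sum_congr rfl fun c hc => by
    rw [h _ ((mem_invCodes.1 hc).1 m (by simp; omega))]

theorem codeSum_add (q m : ℕ) (f g : ℕ → ℕ) :
    codeSum q m (fun u => f u + g u) = codeSum q m f + codeSum q m g := by
  simp only [codeSum, mul_add, sum_add_distrib]

theorem codeSum_mul_left (q m a : ℕ) (f : ℕ → ℕ) :
    codeSum q m (fun u => a * f u) = a * codeSum q m f := by
  simp only [codeSum, mul_left_comm _ a, mul_sum]

theorem codeSum_sum (q m d : ℕ) (f : ℕ → ℕ → ℕ) :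
    codeSum q m (fun u => ∑ e ∈ range d, f e u) = ∑ e ∈ range d, codeSum q m (f e) := by
  simp only [codeSum, mul_sum]
  rw [sum_comm]

theorem sum_stepWeight_mul_ite {q m d : ℕ} (u : ℕ) (hd : q + d ≤ m) :
    ∑ v ∈ range m, stepWeight q u v * (if v < q + d then 1 else 0) =
      q ^ 2 + ∑ e ∈ range d, if u < q + e then 1 else 0 := by
  simp only [mul_ite, mul_one, mul_zero]
  rw [← sum_filter, show (range m).filter (· < q + d) = range (q + d) by ext; simp; omega,
    sum_range_add]
  congr 1
  · rw [sum_congr rfl fun v hv => by rw [stepWeight, if_pos (mem_range.1 hv)]]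
    simp [sq]
  · exact sum_congr rfl fun e _ => by simp [stepWeight]

theorem codeSum_lt {q : ℕ} (hq : 0 < q) (t : ℕ) : ∀ d ≤ t,
    codeSum q (q + t) (fun v => if v < q + d then 1 else 0) =
      q.factorial * ∑ s ∈ range (t + 1), d.choose (t - s) * touchard (q ^ 2) s := by
  induction t with
  | zero =>
    intro d hd
    obtain rfl : d = 0 := by omega
    rw [codeSum_congr (by omega) (g := fun _ => 1) fun u hu => by simp_all]
    simp [codeSum, card_invCodes, touchard]
  | succ t ih =>
    intro d hd
    rw [← add_assoc, codeSum_succ (by omega)]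
    simp only [sum_stepWeight_mul_ite _ (show q + d ≤ q + t + 1 by omega)]
    rw [codeSum_add, codeSum_sum, sum_congr rfl fun e he => ih e (by grind)]
    have hconst : codeSum q (q + t) (fun _ => q ^ 2) =
        q.factorial * touchard (q ^ 2) (t + 1) := by
      rw [codeSum_congr (by omega) (g := fun v => q ^ 2 * if v < q + t then 1 else 0)
        fun u hu => by simp [hu], codeSum_mul_left, ih t le_rfl, touchard_succ, mul_left_comm]
      congr 2
      refine sum_congr rfl fun s hs => ?_
      rw [Nat.choose_symm (by grind)]
    rw [hconst, ← mul_sum, ← mul_add, sum_comm, sum_range_succ _ (t + 1), add_comm]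
    congr 2
    · refine sum_congr rfl fun s hs => ?_
      rw [← sum_mul, show t + 1 - s = (t - s) + 1 by grind]
      congr 1
      exact sum_range_choose_right d (t - s)
    · simp

/-- For all positive integers `q` and `n`,
`q · Σ_{σ ∈ S_{n+q-1}, Del_q(σ)-1 = Des_q(σ)} q^{#Del_q(σ)} = (q-1)! · Σ_k q^{2k} S(n,k)
 = (q-1)! · b_{q²}(n)`. -/
theorem weighted_sum_qBell (q n : ℕ) (hq : 0 < q) (hn : 0 < n) :
    (q * ∑ σ ∈ Finset.univ.filter (fun σ : Equiv.Perm (Fin (n + q - 1)) =>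
          (DelQ q (n + q - 1) (natPerm σ)).image (fun i => i - 1) =
            DesQ q (n + q - 1) (natPerm σ)),
        q ^ (DelQ q (n + q - 1) (natPerm σ)).card) =
      Nat.factorial (q - 1) * ∑ k ∈ Finset.range (n + 1), q ^ (2 * k) * stirling2 n k ∧
    (Nat.factorial (q - 1) * ∑ k ∈ Finset.range (n + 1), q ^ (2 * k) * stirling2 n k) =
      Nat.factorial (q - 1) * qBell (q ^ 2) n := by
  refine ⟨?_, by simp only [qBell, pow_mul]⟩
  have hB : ∑ k ∈ Finset.range (n + 1), q ^ (2 * k) * stirling2 n k = touchard (q ^ 2) n := by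
    simp only [← qBell_eq_touchard, qBell, pow_mul]
  obtain ⟨t, rfl⟩ : ∃ t, n = t + 1 := ⟨n - 1, by omega⟩
  have hm : t + 1 + q - 1 = q + t := by omega
  rw [hB, hm, sum_filter, sum_congr rfl fun σ _ => ite_pow_card_DelQ_eq_prod hq σ,
    sum_invCode (q + t) fun c => ∏ i ∈ Ico q (q + t), stepWeight q (c i) (c (i + 1))]
  have h := codeSum_lt hq t t le_rfl
  rw [codeSum_congr (by omega) (g := fun _ => 1) fun u hu => by simp [hu]] at h
  simp only [codeSum, mul_one] at h
  rw [h, touchard_succ, ← Nat.mul_factorial_pred hq.ne',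
    sum_congr rfl fun s hs => by rw [Nat.choose_symm (by grind)]]
  ring
end
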